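/- Let q = 2^s, β ∈ F_{q^3} nonzero, and let u ∈ F_{q^3} satisfy (βu)^q + βu = β + β^{q^2}. Then the set of all solutions u of this equation is {β^{q-1} + 1 + c/β : c ∈ F_q}. -/

import Mathlib

theorem charP_two_of_card_eq_two_pow {K : Type*} [Field K] [Fintype K] {n : ℕ}
    (hK : Fintype.card K = 2 ^ n) : CharP K 2 := by
  have h : ((2 : K)) ^ n = 0 := by
    have := FiniteField.cast_card_eq_zero K
    rw [hK] at this
    exact_mod_cast this
  exact CharTwo.of_one_ne_zero_of_two_eq_zero one_ne_zero (eq_zero_of_pow_eq_zero h)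

theorem stmt_19 (s : ℕ) (hs : 0 < s) (q : ℕ) (hq : q = 2 ^ s)
    (K : Type*) [Field K] [Fintype K] (hK : Fintype.card K = q ^ 3)
    (β : K) (hβ : β ≠ 0) :
    {u : K | (β * u) ^ q + β * u = β + β ^ q ^ 2} =
      {u : K | ∃ c : K, c ^ q = c ∧ u = β ^ (q - 1) + 1 + c / β} := by
  have : CharP K 2 := charP_two_of_card_eq_two_pow (n := s * 3) (by rw [hK, hq, pow_mul])
  have h2 : (2 : K) = 0 := CharTwo.two_eq_zero
  have hadd (x y : K) : (x + y) ^ q = x ^ q + y ^ q := by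
    rw [hq]; exact add_pow_char_pow x y 2 s
  have hβq : β ^ (q - 1) * β = β ^ q := pow_sub_one_mul (by rw [hq]; positivity) β
  have hqq : (β ^ q) ^ q = β ^ q ^ 2 := by rw [← pow_mul, sq]
  ext u
  simp only [Set.mem_ofPred_eq]
  constructor
  · intro hu
    refine ⟨β * u + (β ^ q + β), ?_, ?_⟩
    · rw [hadd, hadd, hqq]
      linear_combination hu + (β ^ q ^ 2 - β * u) * h2
    · field_simp
      linear_combination -hβq - (β ^ q + β) * h2
  · rintro ⟨c, hc, rfl⟩
    have hmul : β * (β ^ (q - 1) + 1 + c / β) = β ^ q + β + c := by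
      field_simp
      linear_combination hβq
    rw [hmul, hadd, hadd, hqq, hc]
    linear_combination (β ^ q + c) * h2
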